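/- arXiv:2404.07377 — 5 statements merged into one kernel-verified Lean document; each statement's English description precedes it below -/
import Mathlib

section
/- Gibbs variational principle (dual side of the Donsker–Varadhan representation): Let P be a probability measure on a measurable space Ω and f : Ω → ℝ a bounded measurable function. Then log ∫ e^f dP equals the supremum, over all probability measures Q on Ω that are absolutely continuous with respect to P and have D(Q ∥ P) < ∞, of ∫ f dQ − D(Q ∥ P). -/
open MeasureTheory Real
open scoped Classical

/-- The Kullback–Leibler divergence `D(μ ∥ ν)`, with values in `[0, ∞]`: it is
`∫ log (dμ/dν) dμ` when `μ ≪ ν` and the integral is defined, and `∞` otherwise. -/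
noncomputable def klDiv {α : Type*} [MeasurableSpace α] (μ ν : Measure α) : ENNReal :=
  if μ ≪ ν ∧ Integrable (llr μ ν) μ then ENNReal.ofReal (∫ x, llr μ ν x ∂μ) else ⊤

/-- **Gibbs' inequality** for probability measures. -/
lemma integral_llr_nonneg {α : Type*} [MeasurableSpace α] {μ ν : Measure α}
    [IsProbabilityMeasure μ] [IsProbabilityMeasure ν] (hμν : μ ≪ ν)
    (h_int : Integrable (llr μ ν) μ) : 0 ≤ ∫ x, llr μ ν x ∂μ := by
  simpa using InformationTheory.integral_llr_add_sub_measure_univ_nonneg hμν h_int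

lemma klDiv_lt_top_iff {α : Type*} [MeasurableSpace α] {μ ν : Measure α} :
    klDiv μ ν < ⊤ ↔ μ ≪ ν ∧ Integrable (llr μ ν) μ := by
  unfold klDiv
  split_ifs with h <;> simp [h]

lemma toReal_klDiv {α : Type*} [MeasurableSpace α] {μ ν : Measure α}
    [IsProbabilityMeasure μ] [IsProbabilityMeasure ν] (hμν : μ ≪ ν)
    (h_int : Integrable (llr μ ν) μ) : (klDiv μ ν).toReal = ∫ x, llr μ ν x ∂μ := by
  rw [klDiv, if_pos ⟨hμν, h_int⟩, ENNReal.toReal_ofReal (integral_llr_nonneg hμν h_int)]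

/-- Gibbs variational principle: for a probability measure `P` and a bounded
measurable `f`, `log ∫ e^f dP` is the supremum (least upper bound), over all
probability measures `Q ≪ P` with `D(Q ∥ P) < ∞`, of `∫ f dQ − D(Q ∥ P)`. -/
theorem gibbs_variational_principle {Ω : Type*} [MeasurableSpace Ω]
    (P : Measure Ω) [IsProbabilityMeasure P]
    (f : Ω → ℝ) (hf_meas : Measurable f) (hf_bdd : ∃ C : ℝ, ∀ x, |f x| ≤ C) :
    IsLUB {r : ℝ | ∃ Q : Measure Ω, IsProbabilityMeasure Q ∧ Q ≪ P ∧ klDiv Q P < ⊤ ∧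
        r = (∫ x, f x ∂Q) - (klDiv Q P).toReal}
      (Real.log (∫ x, Real.exp (f x) ∂P)) := by
  obtain ⟨C, hC⟩ := hf_bdd
  have hf_int (Q : Measure Ω) [IsProbabilityMeasure Q] : Integrable f Q :=
    .of_bound hf_meas.aestronglyMeasurable C (.of_forall hC)
  have hexp : Integrable (fun x ↦ exp (f x)) P :=
    .of_bound hf_meas.exp.aestronglyMeasurable (exp C) (.of_forall fun x ↦ by
      simpa using (abs_le.mp (hC x)).2)
  have : IsProbabilityMeasure (P.tilted f) := isProbabilityMeasure_tilted hexp
  constructor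
  · rintro r ⟨Q, hQ, hQP, hkl, rfl⟩
    have hllr := (klDiv_lt_top_iff.mp hkl).2
    have hGibbs := integral_llr_nonneg (hQP.trans (absolutelyContinuous_tilted hexp))
      (integrable_llr_tilted_right hQP (hf_int Q) hllr hexp)
    rw [integral_llr_tilted_right hQP (hf_int Q) hexp hllr] at hGibbs
    rw [toReal_klDiv hQP hllr]
    linarith
  · have hac : P.tilted f ≪ P := tilted_absolutelyContinuous P f
    have hllr_eq : llr (P.tilted f) P =ᵐ[P.tilted f]
        fun x ↦ f x - log (∫ x, exp (f x) ∂P) :=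
      hac.ae_le (log_rnDeriv_tilted_left_self hexp)
    have hllr : Integrable (llr (P.tilted f) P) (P.tilted f) :=
      ((hf_int _).sub (integrable_const _)).congr hllr_eq.symm
    intro b hb
    refine hb ⟨P.tilted f, this, hac, klDiv_lt_top_iff.mpr ⟨hac, hllr⟩, ?_⟩
    rw [toReal_klDiv hac hllr, integral_congr_ae hllr_eq,
      integral_sub (hf_int _) (integrable_const _)]
    simp
end

section
/- Telescoping decomposition of the divergence to the product of marginals along the dependency-diffusion path (Watanabe decomposition): Let d ≥ 1 and let P be a probability measure on a finite product Π_{i ∈ Fin d} α_i of measurable spaces. For each i let P_i be the i-th one-dimensional marginal of P, and for 1 ≤ k ≤ d let P_{≤k} be the marginal of P on the first k coordinates. Then D(P ∥ ⊗_{i} P_i) = Σ_{k=1}^{d−1} D(P_{≤k+1} ∥ P_{≤k} ⊗ P_{k+1}), the equality holding in [0, ∞]. -/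
open MeasureTheory Real
open scoped Classical

universe u

open ProbabilityTheory

lemma klDiv_eq_informationTheory_klDiv {β : Type*} [MeasurableSpace β] (μ ν : Measure β)
    [IsProbabilityMeasure μ] [IsProbabilityMeasure ν] :
    klDiv μ ν = InformationTheory.klDiv μ ν := by
  rw [klDiv, InformationTheory.klDiv_def]
  simp

lemma klDiv_map_measurableEquiv {β γ : Type*} [MeasurableSpace β] [MeasurableSpace γ]
    (μ ν : Measure β) [IsProbabilityMeasure μ] [IsProbabilityMeasure ν] (e : β ≃ᵐ γ) :
    klDiv (μ.map e) (ν.map e) = klDiv μ ν := by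
  have := Measure.isProbabilityMeasure_map (μ := μ) e.measurable.aemeasurable
  have := Measure.isProbabilityMeasure_map (μ := ν) e.measurable.aemeasurable
  simp only [klDiv_eq_informationTheory_klDiv]
  refine le_antisymm (InformationTheory.klDiv_map_le _ _ e.measurable) ?_
  simpa [Measure.map_map e.symm.measurable e.measurable] using
    InformationTheory.klDiv_map_le (μ.map e) (ν.map e) e.symm.measurable

/-- A finite measure dominated by a product measure disintegrates along its first marginal,
without any assumption on the measurable spaces. -/
lemma exists_isMarkovKernel_fst_compProd_eq {X Y : Type*} [MeasurableSpace X] [MeasurableSpace Y]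
    (ρ : Measure (X × Y)) [IsFiniteMeasure ρ] (ν : Measure X) [SigmaFinite ν]
    (η : Measure Y) [IsProbabilityMeasure η] (h : ρ ≪ ν.prod η) :
    ∃ κ : Kernel X Y, IsMarkovKernel κ ∧ ρ.fst ⊗ₘ κ = ρ := by
  set f := ρ.rnDeriv (ν.prod η) with hf_def
  have hf : Measurable f := Measure.measurable_rnDeriv _ _
  set g : X → ENNReal := fun x ↦ ∫⁻ y, f (x, y) ∂η with hg_def
  have hg : Measurable g := hf.lintegral_prod_right'
  have hρ : (ν.prod η).withDensity f = ρ := Measure.withDensity_rnDeriv_eq _ _ h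
  have hfst : ρ.fst = ν.withDensity g := by
    ext s hs
    rw [Measure.fst_apply hs, withDensity_apply _ hs, ← hρ,
      withDensity_apply _ (measurable_fst hs), ← Set.prod_univ,
      setLIntegral_prod _ hf.aemeasurable]
    simp [hg_def]
  have hg_top : ∀ᵐ x ∂ν, g x < ⊤ := by
    refine ae_lt_top hg ?_
    have : ∫⁻ x, g x ∂ν = ρ.fst Set.univ := by simp [hfst]
    rw [this]
    exact measure_ne_top _ _
  set A : Set X := {x | g x = 0 ∨ g x = ⊤} with hA_def
  have hA : MeasurableSet A :=
    (hg (measurableSet_singleton 0)).union (hg (measurableSet_singleton ⊤))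
  let q : X → Y → ENNReal := fun x y ↦ if x ∈ A then 1 else (g x)⁻¹ * f (x, y)
  have hq : Measurable (Function.uncurry q) :=
    Measurable.ite (measurable_fst hA) measurable_const ((hg.comp measurable_fst).inv.mul hf)
  have hfx (x : X) : Measurable fun y ↦ f (x, y) := hf.comp measurable_prodMk_left
  let κ : Kernel X Y := Kernel.withDensity (Kernel.const X η) q
  have hκ (x : X) (s : Set Y) : κ x s = ∫⁻ y in s, q x y ∂η := by
    simp only [κ, Kernel.withDensity_apply' _ hq, Kernel.const_apply]
  have hκ' (x : X) (hx : x ∉ A) (s : Set Y) : κ x s = (g x)⁻¹ * ∫⁻ y in s, f (x, y) ∂η := by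
    rw [hκ]
    simp only [q, hx, if_false]
    rw [lintegral_const_mul _ (hfx x)]
  have hmarkov : IsMarkovKernel κ := by
    refine ⟨fun x ↦ ⟨?_⟩⟩
    by_cases hx : x ∈ A
    · rw [hκ]
      simp [q, hx]
    · rw [hκ' x hx, setLIntegral_univ]
      simp only [hA_def, Set.mem_ofPred_eq, not_or] at hx
      exact ENNReal.inv_mul_cancel hx.1 hx.2
  refine ⟨κ, hmarkov, ?_⟩
  ext s hs
  have hsx (x : X) : MeasurableSet (Prod.mk x ⁻¹' s) := measurable_prodMk_left hs
  rw [Measure.compProd_apply hs, hfst,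
    lintegral_withDensity_eq_lintegral_mul _ hg (Kernel.measurable_kernel_prodMk_left hs)]
  conv_rhs => rw [← hρ, withDensity_apply _ hs, ← lintegral_indicator hs,
    lintegral_prod _ (hf.indicator hs).aemeasurable]
  refine lintegral_congr_ae ?_
  filter_upwards [hg_top] with x hx
  have hind : ∫⁻ y, s.indicator f (x, y) ∂η = ∫⁻ y in Prod.mk x ⁻¹' s, f (x, y) ∂η := by
    rw [← lintegral_indicator (hsx x)]
    rfl
  rw [hind, Pi.mul_apply]
  by_cases h0 : g x = 0
  · rw [h0, zero_mul]
    exact (le_antisymm ((setLIntegral_le_lintegral _ _).trans h0.le) zero_le).symm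
  · rw [hκ' x (by simp [hA_def, h0, hx.ne]), ← mul_assoc, ENNReal.mul_inv_cancel h0 hx.ne, one_mul]

/-- Chain rule for the divergence to a product measure whose second factor is the second marginal. -/
lemma klDiv_prod_snd_eq_add {X Y : Type*} [MeasurableSpace X] [MeasurableSpace Y]
    (ρ : Measure (X × Y)) [IsProbabilityMeasure ρ] (ν : Measure X) [IsProbabilityMeasure ν] :
    klDiv ρ (ν.prod ρ.snd) = klDiv ρ.fst ν + klDiv ρ (ρ.fst.prod ρ.snd) := by
  simp only [klDiv_eq_informationTheory_klDiv]
  by_cases h : ρ ≪ ν.prod ρ.snd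
  · obtain ⟨κ, hκ, hρ⟩ := exists_isMarkovKernel_fst_compProd_eq ρ ν ρ.snd h
    have := InformationTheory.klDiv_compProd_eq_add ρ.fst ν κ (Kernel.const X ρ.snd)
    rwa [hρ, Measure.compProd_const, Measure.compProd_const] at this
  · rw [InformationTheory.klDiv_of_not_ac h]
    by_cases h1 : ρ.fst ≪ ν
    · have h2 : ¬ ρ ≪ ρ.fst.prod ρ.snd := fun h2 ↦ h (h2.trans (h1.prod .rfl))
      simp [InformationTheory.klDiv_of_not_ac h2]
    · simp [InformationTheory.klDiv_of_not_ac h1]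

/-- A dependent tuple is its initial segment together with its last entry. -/
def piFinInitLast {n : ℕ} (α : Fin (n + 1) → Type*) [∀ i, MeasurableSpace (α i)] :
    (Π i, α i) ≃ᵐ (Π i : Fin n, α i.castSucc) × α (Fin.last n) where
  toFun x := (fun i => x i.castSucc, x (Fin.last n))
  invFun p := Fin.snoc p.1 p.2
  left_inv x := Fin.snoc_init_self x
  right_inv p := by simp
  measurable_toFun := by
    change Measurable fun x : Π i, α i => (fun i : Fin n => x i.castSucc, x (Fin.last n))
    fun_prop
  measurable_invFun := by
    change Measurable fun p : (Π i : Fin n, α i.castSucc) × α (Fin.last n) =>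
      (Fin.snoc p.1 p.2 : Π i, α i)
    refine measurable_pi_iff.2 fun i => ?_
    induction i using Fin.lastCases with
    | last => simpa using measurable_snd
    | cast i => simpa using! (measurable_pi_apply i).comp measurable_fst

lemma map_piFinInitLast_pi {n : ℕ} {α : Fin (n + 1) → Type*} [∀ i, MeasurableSpace (α i)]
    (μ : Π i, Measure (α i)) [∀ i, SigmaFinite (μ i)] :
    (Measure.pi μ).map (piFinInitLast α)
      = (Measure.pi fun i : Fin n => μ i.castSucc).prod (μ (Fin.last n)) := by
  rw [MeasurableEquiv.map_apply_eq_iff_map_symm_apply_eq]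
  refine Measure.pi_eq fun s _ => ?_
  have hpre : (piFinInitLast α).symm ⁻¹' Set.univ.pi s
      = (Set.univ.pi fun i : Fin n => s i.castSucc) ×ˢ s (Fin.last n) := by
    rw [← MeasurableEquiv.image_eq_preimage_symm]
    ext p
    obtain ⟨x, rfl⟩ := (piFinInitLast α).surjective p
    simp only [MeasurableEquiv.image_eq_preimage_symm, Set.mem_preimage,
      MeasurableEquiv.symm_apply_apply, Set.mem_pi, Set.mem_univ, true_imp_iff, Set.mem_prod,
      Fin.forall_fin_succ']
    rfl
  rw [MeasurableEquiv.map_apply, hpre, Measure.prod_prod, Measure.pi_pi, Fin.prod_univ_castSucc]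

/-- Splitting off the last coordinate in the divergence to the product of the marginals. -/
lemma klDiv_pi_marginals_succ {n : ℕ} {α : Fin (n + 1) → Type*}
    [∀ i, MeasurableSpace (α i)] (P : Measure (Π i, α i)) [IsProbabilityMeasure P] :
    klDiv P (Measure.pi fun i => P.map fun x => x i)
      = klDiv (P.map fun x (i : Fin n) => x i.castSucc)
          (Measure.pi fun i : Fin n => P.map fun x => x i.castSucc)
        + klDiv (P.map fun x => (fun i : Fin n => x i.castSucc, x (Fin.last n)))
          ((P.map fun x (i : Fin n) => x i.castSucc).prod (P.map fun x => x (Fin.last n))) := by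
  have hprob (i) : IsProbabilityMeasure (P.map fun x => x i) :=
    Measure.isProbabilityMeasure_map (measurable_pi_apply i).aemeasurable
  have hpair : Measurable fun x : Π i, α i => (fun i : Fin n => x i.castSucc, x (Fin.last n)) :=
    (piFinInitLast α).measurable
  have := Measure.isProbabilityMeasure_map (μ := P) hpair.aemeasurable
  have h := klDiv_prod_snd_eq_add
    (P.map fun x => (fun i : Fin n => x i.castSucc, x (Fin.last n)))
    (Measure.pi fun i : Fin n => P.map fun x => x i.castSucc)
  have hfst : (P.map fun x => (fun i : Fin n => x i.castSucc, x (Fin.last n))).fst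
      = P.map fun x (i : Fin n) => x i.castSucc :=
    Measure.fst_map_prodMk (measurable_pi_apply _)
  have hsnd : (P.map fun x => (fun i : Fin n => x i.castSucc, x (Fin.last n))).snd
      = P.map fun x => x (Fin.last n) :=
    Measure.snd_map_prodMk (by fun_prop)
  rw [hfst, hsnd] at h
  rw [← klDiv_map_measurableEquiv _ _ (piFinInitLast α), map_piFinInitLast_pi]
  exact h

lemma klDiv_pi_marginals_eq_sum {n : ℕ} {α : Fin (n + 1) → Type u}
    [∀ i, MeasurableSpace (α i)] (P : Measure (Π i, α i)) [IsProbabilityMeasure P] :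
    klDiv P (Measure.pi fun i => P.map fun x => x i)
      = ∑ j : Fin n,
          klDiv
            (P.map fun x => (fun i : Fin (j.val + 1) => x (Fin.castLE (by omega) i), x j.succ))
            ((P.map fun x (i : Fin (j.val + 1)) => x (Fin.castLE (by omega) i)).prod
              (P.map fun x => x j.succ)) := by
  induction n with
  | zero =>
    have hprob (i) : IsProbabilityMeasure (P.map fun x => x i) :=
      Measure.isProbabilityMeasure_map (measurable_pi_apply i).aemeasurable
    have hpi : (Measure.pi fun i => P.map fun x => x i) = P := by
      refine Measure.pi_eq fun s hs => ?_
      rw [Fin.prod_univ_one, Measure.map_apply (measurable_pi_apply 0) (hs 0)]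
      congr 1
      ext x
      simp [Fin.forall_fin_one]
    simp [hpi, klDiv_eq_informationTheory_klDiv, InformationTheory.klDiv_self]
  | succ n ih =>
    have hinit : Measurable fun (x : Π i, α i) (i : Fin (n + 1)) => x i.castSucc := by fun_prop
    have := Measure.isProbabilityMeasure_map (μ := P) hinit.aemeasurable
    have h := ih (P.map fun x (i : Fin (n + 1)) => x i.castSucc)
    simp only [Measure.map_map (measurable_pi_apply _) hinit] at h
    rw [klDiv_pi_marginals_succ, Fin.sum_univ_castSucc]
    refine congrArg₂ (· + ·) (h.trans (Finset.sum_congr rfl fun j _ => ?_)) rfl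
    rw [Measure.map_map (by fun_prop) hinit, Measure.map_map (by fun_prop) hinit]
    rfl

/-- Telescoping (Watanabe) decomposition of the divergence to the product of the
marginals along the dependency-diffusion path: for a probability measure `P` on
`Π i : Fin d, α i`,
`D(P ∥ ⊗ᵢ Pᵢ) = Σ_{k=1}^{d−1} D(P_{≤k+1} ∥ P_{≤k} ⊗ P_{k+1})` in `[0, ∞]`,
where the marginal `P_{≤k+1}` on the first `k+1` coordinates is represented on
the product type `(Π i : Fin k, α i) × α k`. -/
theorem watanabe_telescoping {d : ℕ} (hd : 1 ≤ d) {α : Fin d → Type u}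
    [∀ i, MeasurableSpace (α i)] (P : Measure (Π i, α i)) [IsProbabilityMeasure P] :
    klDiv P (Measure.pi fun i => P.map fun x => x i)
      = ∑ j : Fin (d - 1),
          klDiv
            (P.map (fun x =>
              (((fun i : Fin (j.val + 1) =>
                  x (Fin.castLE (by have := j.isLt; omega) i)) :
                  Π i : Fin (j.val + 1), α (Fin.castLE (by have := j.isLt; omega) i)),
                x ⟨j.val + 1, by have := j.isLt; omega⟩)))
            ((P.map (fun x => ((fun i : Fin (j.val + 1) =>
                x (Fin.castLE (by have := j.isLt; omega) i)) :
                Π i : Fin (j.val + 1), α (Fin.castLE (by have := j.isLt; omega) i)))).prod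
              (P.map (fun x => x ⟨j.val + 1, by have := j.isLt; omega⟩))) := by
  obtain ⟨n, rfl⟩ : ∃ n, d = n + 1 := ⟨d - 1, by omega⟩
  exact klDiv_pi_marginals_eq_sum P
end

section
/- Theorem 2 of the paper (bound on the empirical dual divergence of generated samples with respect to real samples via the maximal nearest-neighbor distance in the dual space): Let α be a type, f : α → ℝ a function, X_g a nonempty finite set of m generated points in α and X a nonempty finite set of n real points in α. Let d_max = max_{g ∈ X_g} min_{x ∈ X} |f(g) − f(x)| be the maximal distance from a generated point to its nearest real point in the one-dimensional dual space. Then the empirical dual (Donsker–Varadhan) objective satisfies (1/m) Σ_{g ∈ X_g} f(g) − log( (1/n) Σ_{x ∈ X} e^{f(x)} ) ≤ d_max + log n. -/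
open Finset

/-- Theorem 2 of the paper: the empirical dual (Donsker–Varadhan) objective of the
generated set `X_g` w.r.t. the real set `X` under the dual function `f` is bounded
by `d_max + log n`, where `d_max` is the maximal distance from a generated point to
its nearest real point in the one-dimensional dual space and `n` is the number of
real points. -/
theorem empirical_dual_div_le_max_nn_dist {α : Type*} (f : α → ℝ)
    (Xg X : Finset α) (hXg : Xg.Nonempty) (hX : X.Nonempty) :
    (1 / (Xg.card : ℝ)) * ∑ g ∈ Xg, f g
        - Real.log ((1 / (X.card : ℝ)) * ∑ x ∈ X, Real.exp (f x))
      ≤ Xg.sup' hXg (fun g => X.inf' hX fun x => |f g - f x|)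
        + Real.log (X.card : ℝ) := by
  have hsum : 0 < ∑ x ∈ X, Real.exp (f x) := sum_pos (fun x _ => Real.exp_pos _) hX
  have hn : (0 : ℝ) < X.card := by exact_mod_cast hX.card_pos
  have hm : (0 : ℝ) < Xg.card := by exact_mod_cast hXg.card_pos
  set d := Xg.sup' hXg (fun g => X.inf' hX fun x => |f g - f x|)
  have hle : ∀ g ∈ Xg, f g ≤ d + Real.log (∑ x ∈ X, Real.exp (f x)) := by
    intro g hg
    obtain ⟨x, hx, hmin⟩ := exists_mem_eq_inf' hX fun x => |f g - f x|
    have hdist : |f g - f x| ≤ d :=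
      hmin ▸ le_sup' (fun g => X.inf' hX fun x => |f g - f x|) hg
    have hlog : f x ≤ Real.log (∑ x ∈ X, Real.exp (f x)) :=
      (Real.le_log_iff_exp_le hsum).2
        (single_le_sum (f := fun x => Real.exp (f x)) (fun y _ => (Real.exp_pos _).le) hx)
    linarith [le_abs_self (f g - f x)]
  have hmean : (1 / (Xg.card : ℝ)) * ∑ g ∈ Xg, f g
      ≤ d + Real.log (∑ x ∈ X, Real.exp (f x)) := by
    rw [one_div, inv_mul_le_iff₀ hm, ← nsmul_eq_mul]
    exact sum_le_card_nsmul Xg f _ hle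
  rw [Real.log_mul (one_div_pos.2 hn).ne' hsum.ne', one_div (X.card : ℝ), Real.log_inv]
  linarith
end

section
/- Averaged refinement of Theorem 2: Let α be a type, f : α → ℝ a function, X_g a nonempty finite set of m generated points in α and X a nonempty finite set of n real points in α. Then (1/m) Σ_{g ∈ X_g} f(g) − log( (1/n) Σ_{x ∈ X} e^{f(x)} ) ≤ (1/m) Σ_{g ∈ X_g} ( min_{x ∈ X} |f(g) − f(x)| ) + log n; that is, the empirical dual divergence of the generated set with respect to the real set is bounded by the average nearest-neighbor distance in the one-dimensional dual space plus log n. -/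
open Finset

/-- A single value is at most the log-sum-exp over a finite set containing the point. -/
theorem le_log_sum_exp {α : Type*} (f : α → ℝ) {X : Finset α} {x : α} (hx : x ∈ X) :
    f x ≤ Real.log (∑ y ∈ X, Real.exp (f y)) := by
  rw [Real.le_log_iff_exp_le (Finset.sum_pos (fun y _ => Real.exp_pos (f y)) ⟨x, hx⟩)]
  exact Finset.single_le_sum (f := fun y => Real.exp (f y)) (fun y _ => (Real.exp_pos _).le) hx

/-- Averaged refinement of Theorem 2: the empirical dual (Donsker–Varadhan)
objective of the generated set `X_g` w.r.t. the real set `X` under the dual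
function `f` is bounded by the average nearest-neighbor distance in the
one-dimensional dual space plus `log n`. -/
theorem empirical_dual_div_le_avg_nn_dist {α : Type*} (f : α → ℝ)
    (Xg X : Finset α) (hXg : Xg.Nonempty) (hX : X.Nonempty) :
    (1 / (Xg.card : ℝ)) * ∑ g ∈ Xg, f g
        - Real.log ((1 / (X.card : ℝ)) * ∑ x ∈ X, Real.exp (f x))
      ≤ (1 / (Xg.card : ℝ)) * ∑ g ∈ Xg, (X.inf' hX fun x => |f g - f x|)
        + Real.log (X.card : ℝ) := by
  have hm : (0 : ℝ) < Xg.card := by exact_mod_cast hXg.card_pos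
  have hn : (0 : ℝ) < X.card := by exact_mod_cast hX.card_pos
  have hS : 0 < ∑ x ∈ X, Real.exp (f x) := Finset.sum_pos (fun x _ => Real.exp_pos _) hX
  have hlog : Real.log ((1 / (X.card : ℝ)) * ∑ x ∈ X, Real.exp (f x))
      = Real.log (∑ x ∈ X, Real.exp (f x)) - Real.log X.card := by
    rw [one_div_mul_eq_div, Real.log_div hS.ne' hn.ne']
  have hpt : ∀ g ∈ Xg, f g ≤ (X.inf' hX fun x => |f g - f x|)
      + Real.log (∑ x ∈ X, Real.exp (f x)) := by
    intro g _
    obtain ⟨x, hx, hmin⟩ := X.exists_mem_eq_inf' hX fun x => |f g - f x|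
    rw [hmin]
    linarith [le_abs_self (f g - f x), le_log_sum_exp f hx]
  have havg := mul_le_mul_of_nonneg_left (Finset.sum_le_sum hpt) (one_div_pos.2 hm).le
  rw [Finset.sum_add_distrib, Finset.sum_const, nsmul_eq_mul, mul_add, ← mul_assoc _ (Xg.card : ℝ),
    one_div_mul_cancel hm.ne', one_mul] at havg
  rw [hlog]
  linarith
end

section
/- Finite-sample core of Theorem 1 (variance of the plug-in likelihood-ratio estimator): Let P and Q be probability measures on a measurable space with P absolutely continuous with respect to Q, let r = dP/dQ, and suppose ∫ r² dQ < ∞. For n ≥ 1 consider the product measure Q^{⊗n} and the empirical-mean statistic T(x₁,…,x_n) = (1/n) Σ_{i=1}^n r(x_i). Then the variance of T under Q^{⊗n} equals (∫ r² dQ − 1)/n, and consequently Var_{Q^{⊗n}}(T) ≥ (e^{D(P ∥ Q)} − 1)/n. -/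
open MeasureTheory Real
open scoped Classical

/-- A probability density with finite second moment is square-integrable. -/
theorem memLp_two_toReal_rnDeriv {Ω : Type*} [MeasurableSpace Ω] (P Q : Measure Ω)
    [SigmaFinite P] (h : ∫⁻ x, (P.rnDeriv Q x) ^ 2 ∂Q ≠ ⊤) :
    MemLp (fun x => (P.rnDeriv Q x).toReal) 2 Q := by
  have hm : Measurable (P.rnDeriv Q) := Measure.measurable_rnDeriv P Q
  rw [memLp_two_iff_integrable_sq hm.ennreal_toReal.aestronglyMeasurable]
  simp_rw [← ENNReal.toReal_pow]
  exact integrable_toReal_of_lintegral_ne_top (hm.pow_const 2).aemeasurable h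

theorem integral_sq_toReal_rnDeriv {Ω : Type*} [MeasurableSpace Ω] (P Q : Measure Ω)
    [SigmaFinite P] :
    ∫ x, (P.rnDeriv Q x).toReal ^ 2 ∂Q = (∫⁻ x, (P.rnDeriv Q x) ^ 2 ∂Q).toReal := by
  simp_rw [← ENNReal.toReal_pow]
  refine integral_toReal ((Measure.measurable_rnDeriv P Q).pow_const 2).aemeasurable ?_
  filter_upwards [Measure.rnDeriv_lt_top P Q] with x hx
  exact ENNReal.pow_lt_top hx

/-- The variance of the likelihood ratio `dP/dQ` under `Q` is the `χ²`-divergence. -/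
theorem variance_toReal_rnDeriv {Ω : Type*} [MeasurableSpace Ω] (P Q : Measure Ω)
    [IsProbabilityMeasure P] [IsProbabilityMeasure Q] (hPQ : P ≪ Q)
    (h : ∫⁻ x, (P.rnDeriv Q x) ^ 2 ∂Q ≠ ⊤) :
    ProbabilityTheory.variance (fun x => (P.rnDeriv Q x).toReal) Q
      = (∫⁻ x, (P.rnDeriv Q x) ^ 2 ∂Q).toReal - 1 := by
  rw [ProbabilityTheory.variance_eq_sub (memLp_two_toReal_rnDeriv P Q h),
    Measure.integral_toReal_rnDeriv hPQ, ← integral_sq_toReal_rnDeriv P Q]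
  simp

/-- The Kullback–Leibler divergence is bounded by the logarithm of the second moment of the
likelihood ratio. -/
theorem exp_integral_llr_le {Ω : Type*} [MeasurableSpace Ω] (P Q : Measure Ω)
    [IsProbabilityMeasure P] [IsProbabilityMeasure Q] (hPQ : P ≪ Q)
    (h : ∫⁻ x, (P.rnDeriv Q x) ^ 2 ∂Q ≠ ⊤) (hllr : Integrable (llr P Q) P) :
    exp (∫ x, llr P Q x ∂P) ≤ (∫⁻ x, (P.rnDeriv Q x) ^ 2 ∂Q).toReal := by
  have hexp := exp_llr_of_ac P Q hPQ
  have hint : Integrable (fun x => (P.rnDeriv Q x).toReal) P := by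
    rw [← integrable_rnDeriv_smul_iff hPQ]
    simpa only [smul_eq_mul, ← sq] using (memLp_two_toReal_rnDeriv P Q h).integrable_sq
  calc exp (∫ x, llr P Q x ∂P) ≤ ∫ x, exp (llr P Q x) ∂P :=
        convexOn_exp.map_integral_le continuous_exp.continuousOn isClosed_univ (by simp) hllr
          (hint.congr hexp.symm)
    _ = ∫ x, (P.rnDeriv Q x).toReal ∂P := integral_congr_ae hexp
    _ = ∫ x, (P.rnDeriv Q x).toReal ^ 2 ∂Q := by
        rw [← integral_rnDeriv_smul hPQ]
        simp only [smul_eq_mul, ← sq]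
    _ = (∫⁻ x, (P.rnDeriv Q x) ^ 2 ∂Q).toReal := integral_sq_toReal_rnDeriv P Q

/-- Finite-sample core of Theorem 1: for `P ≪ Q` with `r = dP/dQ` and
`∫ r² dQ < ∞`, the empirical-mean statistic `T(x₁,…,xₙ) = (1/n) Σᵢ r(xᵢ)` has
variance `(∫ r² dQ − 1)/n` under `Q^{⊗n}`, hence at least `(e^{D(P ∥ Q)} − 1)/n`. -/
theorem variance_plugin_likelihood_ratio_estimator {Ω : Type*} [MeasurableSpace Ω]
    (P Q : Measure Ω) [IsProbabilityMeasure P] [IsProbabilityMeasure Q]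
    (hPQ : P ≪ Q) (hχ : ∫⁻ x, (P.rnDeriv Q x) ^ 2 ∂Q ≠ ⊤)
    (n : ℕ) (hn : 1 ≤ n)
    (T : (Fin n → Ω) → ℝ)
    (hT : T = fun x => (1 / (n : ℝ)) * ∑ i, (P.rnDeriv Q (x i)).toReal)
    (Qn : Measure (Fin n → Ω)) (hQn : Qn = Measure.pi fun _ : Fin n => Q) :
    (∫ x, (T x) ^ 2 ∂Qn) - (∫ x, T x ∂Qn) ^ 2
        = ((∫⁻ x, (P.rnDeriv Q x) ^ 2 ∂Q).toReal - 1) / n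
      ∧ (Real.exp (klDiv P Q).toReal - 1) / n
          ≤ (∫ x, (T x) ^ 2 ∂Qn) - (∫ x, T x ∂Qn) ^ 2 := by
  have hr := memLp_two_toReal_rnDeriv P Q hχ
  have hvar := variance_toReal_rnDeriv P Q hPQ hχ
  have hn0 : (n : ℝ) ≠ 0 := by positivity
  have hTmem : MemLp T 2 Qn := by
    rw [hT, hQn]
    exact (memLp_finsetSum _ fun i _ =>
      hr.comp_measurePreserving (measurePreserving_eval (fun _ : Fin n => Q) i)).const_mul _
  have hsum : ProbabilityTheory.variance
      (fun x : Fin n → Ω => ∑ i, (P.rnDeriv Q (x i)).toReal) Qn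
        = n * ((∫⁻ x, (P.rnDeriv Q x) ^ 2 ∂Q).toReal - 1) := by
    have := ProbabilityTheory.variance_sum_pi (μ := fun _ : Fin n => Q) (fun _ => hr)
    rw [hvar] at this
    rw [hQn]
    convert! this using 1
    · congr 1
      ext x
      simp
    · simp [mul_sub]
  have hmain : (∫ x, (T x) ^ 2 ∂Qn) - (∫ x, T x ∂Qn) ^ 2
      = ((∫⁻ x, (P.rnDeriv Q x) ^ 2 ∂Q).toReal - 1) / n := by
    have : IsProbabilityMeasure Qn := hQn ▸ inferInstance
    have hsub := ProbabilityTheory.variance_eq_sub hTmem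
    simp only [Pi.pow_apply] at hsub
    rw [← hsub, hT, ProbabilityTheory.variance_const_mul, hsum]
    field_simp
  refine ⟨hmain, ?_⟩
  rw [hmain]
  have hone : 1 ≤ (∫⁻ x, (P.rnDeriv Q x) ^ 2 ∂Q).toReal := by
    linarith [ProbabilityTheory.variance_nonneg (fun x => (P.rnDeriv Q x).toReal) Q]
  gcongr
  unfold klDiv
  split_ifs with hkl
  · rw [ENNReal.toReal_ofReal', exp_monotone.map_max, exp_zero]
    exact max_le (exp_integral_llr_le P Q hPQ hχ hkl.2) hone
  · simpa using hone
end
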